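/- Let A be an n-dimensional (n > 5) nilpotent non-unital associative algebra over ℂ that is naturally graded, non-split (A is not the direct sum of two nonzero two-sided ideals), and quasi-filiform, i.e. of nilindex n−2 (A^{n−2} ≠ 0 and A^{n−1} = 0). Then A has a basis e_1, …, e_n whose multiplication table is exactly one of the following pairwise non-isomorphic tables (all unlisted products of basis vectors being zero, and in each table e_i·e_j = e_{i+j} for all 2 ≤ i+j ≤ n−2): μ_{2,1}: additionally e_{n−1}·e_1 = e_n; μ_{2,2}(α), α ∈ ℂ: additionally e_1·e_{n−1} = e_n and e_{n−1}·e_1 = α·e_n; μ_{2,3}: additionally e_1·e_{n−1} = e_n, e_{n−1}·e_1 = e_n and e_{n−1}·e_{n−1} = e_n; μ_{2,4}: additionally e_1·e_{n−1} = e_n and e_{n−1}·e_{n−1} = e_n. -/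

import Mathlib

variable (A : Type*) [NonUnitalRing A] [Module ℂ A] [SMulCommClass ℂ A A] [IsScalarTower ℂ A A]

/-- Product of two submodules of a non-unital algebra:
the span of all pairwise products. -/
def pmul (I J : Submodule ℂ A) : Submodule ℂ A :=
  Submodule.span ℂ (Set.image2 (· * ·) (I : Set A) (J : Set A))

/-- The series of powers `A^1 = A`, `A^{i+1} = Σ_{k=1}^{i} A^k · A^{i+1-k}`.
(`algPow A 0` is junk, set to `⊤`.) -/
def algPow : ℕ → Submodule ℂ A
  | 0 => ⊤
  | 1 => ⊤
  | n + 2 => ⨆ k : Fin (n + 1), pmul A (algPow (k + 1)) (algPow (n + 1 - k))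
  termination_by n => n
  decreasing_by
  · omega
  · omega

/-- An algebra is nilpotent if some power `A^m` (`m ≥ 1`) vanishes. -/
def IsNilpotentAlg : Prop :=
  ∃ m : ℕ, 1 ≤ m ∧ algPow A m = ⊥

/-- A natural grading of `A`: a family of submodules `𝒜 1, 𝒜 2, …` (with `𝒜 0 = ⊥`)
such that `A` is their internal direct sum, `𝒜 i · 𝒜 j ⊆ 𝒜 (i+j)` and
`𝒜 (i+1) = 𝒜 1 · 𝒜 i`. -/
structure IsNaturalGrading (𝒜 : ℕ → Submodule ℂ A) : Prop where
  zero : 𝒜 0 = ⊥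
  internal : DirectSum.IsInternal 𝒜
  mul_le : ∀ i j, 1 ≤ i → 1 ≤ j → pmul A (𝒜 i) (𝒜 j) ≤ 𝒜 (i + j)
  succ : ∀ i, 1 ≤ i → 𝒜 (i + 1) = pmul A (𝒜 1) (𝒜 i)

/-- A submodule that is a two-sided ideal. -/
def IsTwoSidedIdealSub (I : Submodule ℂ A) : Prop :=
  ∀ a : A, ∀ x ∈ I, a * x ∈ I ∧ x * a ∈ I

/-- `A` is non-split: it is not the direct sum of two nonzero two-sided ideals. -/
def NonSplit : Prop :=
  ¬ ∃ I J : Submodule ℂ A, IsTwoSidedIdealSub A I ∧ IsTwoSidedIdealSub A J ∧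
      I ≠ ⊥ ∧ J ≠ ⊥ ∧ I ⊓ J = ⊥ ∧ I ⊔ J = ⊤

/-- `e 1, …, e n` is a basis of `A` (indices `1,…,n`). -/
def IsBasisFam (n : ℕ) (e : ℕ → A) : Prop :=
  (LinearIndependent ℂ fun i : Fin n => e (i.1 + 1)) ∧
    Submodule.span ℂ (Set.range fun i : Fin n => e (i.1 + 1)) = ⊤

/-- Coefficients `(c₁, c₂, c₃)` of `e_{n-1}·e_1`, `e_1·e_{n-1}`, `e_{n-1}·e_{n-1}`
(as multiples of `e_n`) for the tables `μ_{2,1}, μ_{2,3}, μ_{2,4}` (via `Sum.inl 0,1,2`)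
and `μ_{2,2}(α)` (via `Sum.inr α`). -/
noncomputable def quasiCoeff : Fin 3 ⊕ ℂ → ℂ × ℂ × ℂ :=
  Sum.elim ![(1, 0, 0), (1, 1, 1), (0, 1, 1)] fun α => (α, 1, 0)

/-- The quasi-filiform multiplication tables: `e_i e_j = e_{i+j}` for `2 ≤ i+j ≤ n-2`,
the products `e_{n-1}·e_1`, `e_1·e_{n-1}`, `e_{n-1}·e_{n-1}` are the indicated multiples
of `e_n`, and all other products of basis vectors are zero. -/
def QuasiFiliformTable (n : ℕ) (t : Fin 3 ⊕ ℂ) (e : ℕ → A) : Prop :=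
  ∀ i j, 1 ≤ i → i ≤ n → 1 ≤ j → j ≤ n →
    e i * e j =
      (if 2 ≤ i + j ∧ i + j ≤ n - 2 then e (i + j) else 0) +
      (if i = n - 1 ∧ j = 1 then (quasiCoeff t).1 • e n else 0) +
      (if i = 1 ∧ j = n - 1 then (quasiCoeff t).2.1 • e n else 0) +
      (if i = n - 1 ∧ j = n - 1 then (quasiCoeff t).2.2 • e n else 0)

set_option linter.unusedSectionVars false

section

variable {A}

theorem mul_mem_pmul {I J : Submodule ℂ A} {a b : A} (ha : a ∈ I) (hb : b ∈ J) :
    a * b ∈ pmul A I J :=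
  Submodule.subset_span ⟨a, ha, b, hb, rfl⟩

theorem pmul_le {I J K : Submodule ℂ A} (h : ∀ a ∈ I, ∀ b ∈ J, a * b ∈ K) : pmul A I J ≤ K := by
  refine Submodule.span_le.2 ?_
  rintro _ ⟨a, ha, b, hb, rfl⟩
  exact h a ha b hb

theorem pmul_le_algPow {i j : ℕ} (hi : 1 ≤ i) (hj : 1 ≤ j) :
    pmul A (algPow A i) (algPow A j) ≤ algPow A (i + j) := by
  obtain ⟨i, rfl⟩ := Nat.exists_eq_add_of_le' hi
  obtain ⟨j, rfl⟩ := Nat.exists_eq_add_of_le' hj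
  have h : i + 1 + (j + 1) = i + j + 2 := by ring
  rw [h, algPow]
  refine le_trans ?_ (le_iSup _ (⟨i, by omega⟩ : Fin (i + j + 1)))
  simp [show i + j + 1 - i = j + 1 by omega]

theorem algPow_add_two_le {n : ℕ} {K : Submodule ℂ A}
    (h : ∀ i j, 1 ≤ i → 1 ≤ j → i + j = n + 2 → pmul A (algPow A i) (algPow A j) ≤ K) :
    algPow A (n + 2) ≤ K := by
  rw [algPow]
  exact iSup_le fun k => h _ _ (by omega) (by omega) (by omega)

namespace IsNaturalGrading

variable {𝒜 : ℕ → Submodule ℂ A} (h : IsNaturalGrading A 𝒜)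
include h

theorem mul_mem {i j : ℕ} (hi : 1 ≤ i) (hj : 1 ≤ j) {a b : A} (ha : a ∈ 𝒜 i) (hb : b ∈ 𝒜 j) :
    a * b ∈ 𝒜 (i + j) :=
  h.mul_le i j hi hj (mul_mem_pmul ha hb)

theorem succ_le {i : ℕ} (hi : 1 ≤ i) {K : Submodule ℂ A}
    (hK : ∀ v ∈ 𝒜 1, ∀ a ∈ 𝒜 i, v * a ∈ K) : 𝒜 (i + 1) ≤ K := by
  rw [h.succ i hi]
  exact pmul_le hK

theorem succ_le_right {i : ℕ} (hi : 1 ≤ i) {K : Submodule ℂ A}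
    (hK : ∀ a ∈ 𝒜 i, ∀ v ∈ 𝒜 1, a * v ∈ K) : 𝒜 (i + 1) ≤ K := by
  suffices 𝒜 (i + 1) ≤ pmul A (𝒜 i) (𝒜 1) from this.trans (pmul_le hK)
  clear hK
  induction i, hi using Nat.le_induction with
  | base => exact (h.succ 1 le_rfl).le
  | succ i hi ih =>
    refine h.succ_le (by omega) fun v hv a ha => ?_
    have : pmul A (𝒜 i) (𝒜 1) ≤
        (pmul A (𝒜 (i + 1)) (𝒜 1)).comap (LinearMap.mulLeft ℂ v) := by
      refine pmul_le fun b hb u hu => ?_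
      simp only [Submodule.mem_comap, LinearMap.mulLeft_apply, ← mul_assoc]
      refine mul_mem_pmul ?_ hu
      rw [add_comm]
      exact h.mul_mem le_rfl hi hv hb
    exact this (ih ha)

theorem le_algPow {i : ℕ} (hi : 1 ≤ i) : 𝒜 i ≤ algPow A i := by
  induction i, hi using Nat.le_induction with
  | base => simp [algPow]
  | succ i hi ih =>
    refine h.succ_le hi fun v hv a ha => ?_
    rw [add_comm]
    exact pmul_le_algPow le_rfl hi (mul_mem_pmul (by simp [algPow]) (ih ha))

theorem eq_bot_of_le {i j : ℕ} (hi : 1 ≤ i) (hij : i ≤ j) (hbot : 𝒜 i = ⊥) : 𝒜 j = ⊥ := by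
  induction j, hij using Nat.le_induction with
  | base => exact hbot
  | succ j hj ih =>
    refine eq_bot_iff.2 (h.succ_le (by omega) fun v _ a ha => ?_)
    rw [ih, Submodule.mem_bot] at ha
    simp [ha]

theorem iSup_eq_top : ⨆ i, 𝒜 i = ⊤ :=
  h.internal.submodule_iSup_eq_top

theorem tail_mul_mem {k l : ℕ} (hk : 1 ≤ k) (hl : 1 ≤ l) {a b : A}
    (ha : a ∈ ⨆ i, ⨆ _ : k ≤ i, 𝒜 i) (hb : b ∈ ⨆ i, ⨆ _ : l ≤ i, 𝒜 i) :
    a * b ∈ ⨆ i, ⨆ _ : k + l ≤ i, 𝒜 i := by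
  have key : ∀ x ∈ ⨆ i, ⨆ _ : k ≤ i, 𝒜 i, (⨆ i, ⨆ _ : l ≤ i, 𝒜 i) ≤
      (⨆ i, ⨆ _ : k + l ≤ i, 𝒜 i).comap (LinearMap.mulLeft ℂ x) := by
    intro x hx
    refine iSup₂_le fun j hj y hy => ?_
    have : (⨆ i, ⨆ _ : k ≤ i, 𝒜 i) ≤
        (⨆ i, ⨆ _ : k + l ≤ i, 𝒜 i).comap (LinearMap.mulRight ℂ y) := by
      refine iSup₂_le fun i hi z hz => ?_
      exact (le_iSup₂ (f := fun i (_ : k + l ≤ i) => 𝒜 i) (i + j) (by omega))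
        (h.mul_mem (by omega) (by omega) hz hy)
    exact this hx
  exact key a ha hb

theorem tail_one : ⨆ i, ⨆ _ : 1 ≤ i, 𝒜 i = ⊤ := by
  rw [← h.iSup_eq_top]
  refine le_antisymm (iSup₂_le fun i _ => le_iSup 𝒜 i) (iSup_le fun i => ?_)
  rcases Nat.eq_zero_or_pos i with rfl | hi
  · simp [h.zero]
  · exact le_iSup₂ (f := fun i (_ : 1 ≤ i) => 𝒜 i) i hi

theorem mul_mem_tail_two (a b : A) : a * b ∈ ⨆ i, ⨆ _ : 2 ≤ i, 𝒜 i :=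
  h.tail_mul_mem le_rfl le_rfl (by simp [h.tail_one]) (by simp [h.tail_one])

theorem algPow_le_tail {k : ℕ} (hk : 1 ≤ k) : algPow A k ≤ ⨆ i, ⨆ _ : k ≤ i, 𝒜 i := by
  induction k using Nat.strong_induction_on with
  | _ k ih =>
    match k, hk with
    | 1, _ => rw [h.tail_one]; exact le_top
    | k + 2, _ =>
      refine algPow_add_two_le fun i j hi hj hij => pmul_le fun a ha b hb => ?_
      rw [← hij]
      exact h.tail_mul_mem hi hj (ih i (by omega) hi ha) (ih j (by omega) hj hb)

theorem ne_bot {i m : ℕ} (hi : 1 ≤ i) (him : i ≤ m) (hm : algPow A m ≠ ⊥) : 𝒜 i ≠ ⊥ := by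
  intro hbot
  refine hm (eq_bot_iff.2 ((h.algPow_le_tail (hi.trans him)).trans (iSup₂_le fun j hj => ?_)))
  rw [h.eq_bot_of_le hi (him.trans hj) hbot]

theorem notMem_tail_two {y : A} (hy : y ∈ 𝒜 1) (hy0 : y ≠ 0) : y ∉ ⨆ i, ⨆ _ : 2 ≤ i, 𝒜 i := by
  intro hmem
  have hle : (⨆ i, ⨆ _ : 2 ≤ i, 𝒜 i) ≤ ⨆ i, ⨆ _ : i ≠ 1, 𝒜 i :=
    iSup₂_le fun i hi => le_iSup₂ (f := fun i (_ : i ≠ 1) => 𝒜 i) i (by omega)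
  exact hy0 (Submodule.disjoint_def.1 (h.internal.submodule_iSupIndep 1) y hy (hle hmem))

theorem sum_finrank [FiniteDimensional ℂ A] {m : ℕ} (hm : ∀ i, m ≤ i → 𝒜 i = ⊥) :
    ∑ i ∈ Finset.range m, Module.finrank ℂ (𝒜 i) = Module.finrank ℂ A := by
  have hind : iSupIndep fun i : Fin m => 𝒜 i :=
    h.internal.submodule_iSupIndep.comp Fin.val_injective
  have htop : ⨆ i : Fin m, 𝒜 i = ⊤ := by
    rw [← top_le_iff, ← h.iSup_eq_top]
    refine iSup_le fun i => ?_
    rcases lt_or_ge i m with hi | hi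
    · exact le_iSup (fun i : Fin m => 𝒜 i) ⟨i, hi⟩
    · simp [hm i hi]
  have hint : DirectSum.IsInternal fun i : Fin m => 𝒜 i :=
    DirectSum.isInternal_submodule_of_iSupIndep_of_iSup_eq_top hind htop
  rw [← Fin.sum_univ_eq_sum_range (fun i => Module.finrank ℂ (𝒜 i)),
    Module.finrank_eq_card_basis (hint.collectedBasis fun i => Module.finBasis ℂ (𝒜 i))]
  simp

end IsNaturalGrading

end

section

variable {A}

theorem le_span_singleton_of_finrank_eq_one {S : Submodule ℂ A} (hS : Module.finrank ℂ S = 1)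
    {w : A} (hw : w ∈ S) (hw0 : w ≠ 0) : S ≤ ℂ ∙ w := by
  intro v hv
  obtain ⟨c, hc⟩ := (finrank_eq_one_iff_of_nonzero' (⟨w, hw⟩ : S) (by simpa using hw0)).1 hS
    ⟨v, hv⟩
  exact Submodule.mem_span_singleton.2 ⟨c, congrArg Subtype.val hc⟩

theorem finrank_span_singleton_le_one (w : A) : Module.finrank ℂ (ℂ ∙ w) ≤ 1 := by
  simpa using finrank_span_le_card (R := ℂ) ({w} : Set A)

theorem span_pair_eq_of_finrank_eq_two {S : Submodule ℂ A} (hS : Module.finrank ℂ S = 2) {x y : A}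
    (hx : x ∈ S) (hy : y ∈ S) (hy0 : y ≠ 0) (hxy : ∀ c : ℂ, c • y ≠ x) :
    Submodule.span ℂ {x, y} = S := by
  have hfin : FiniteDimensional ℂ S := FiniteDimensional.of_finrank_pos (by omega)
  have hle : Submodule.span ℂ {x, y} ≤ S := by
    rw [Submodule.span_le]
    rintro _ (rfl | rfl) <;> assumption
  have hli : LinearIndependent ℂ ![x, y] := by
    rwa [LinearIndependent.pair_symm_iff, LinearIndependent.pair_iff' hy0]
  have hfr := finrank_span_eq_card hli
  rw [show Set.range ![x, y] = {x, y} by simp [Set.pair_comm]] at hfr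
  exact Submodule.eq_of_le_of_finrank_eq hle (by rw [hS, hfr, Fintype.card_fin])

theorem exists_ne_zero_map_eq_zero [FiniteDimensional ℂ A] {S T : Submodule ℂ A} (f : A →ₗ[ℂ] A)
    (hf : ∀ v ∈ S, f v ∈ T) (hlt : Module.finrank ℂ T < Module.finrank ℂ S) :
    ∃ v ∈ S, v ≠ 0 ∧ f v = 0 := by
  obtain ⟨v, hv, hv0⟩ := Submodule.exists_mem_ne_zero_of_ne_bot
    (LinearMap.ker_ne_bot_of_finrank_lt (f := f.restrict hf) hlt)
  exact ⟨v, v.2, by simpa using hv0, congrArg Subtype.val (LinearMap.mem_ker.1 hv)⟩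

/-- The powers `x, x * x, x * (x * x), …` of an element, with the `0`-th power set to `0`. -/
def rightPow (x : A) : ℕ → A
  | 0 => 0
  | 1 => x
  | n + 2 => x * rightPow x (n + 1)

@[simp] theorem rightPow_one (x : A) : rightPow x 1 = x := rfl

theorem rightPow_succ (x : A) {i : ℕ} (hi : 1 ≤ i) : rightPow x (i + 1) = x * rightPow x i := by
  obtain ⟨i, rfl⟩ := Nat.exists_eq_add_of_le' hi
  rfl

theorem rightPow_mul (x : A) {i j : ℕ} (hi : 1 ≤ i) (hj : 1 ≤ j) :
    rightPow x i * rightPow x j = rightPow x (i + j) := by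
  induction i, hi using Nat.le_induction with
  | base => rw [add_comm, rightPow_succ x hj, rightPow_one]
  | succ i hi ih =>
    rw [rightPow_succ x hi, mul_assoc, ih, ← rightPow_succ x (by omega)]
    congr 1
    ring

theorem rightPow_eq_zero_of_le {x : A} {i j : ℕ} (hi : 1 ≤ i) (hij : i ≤ j)
    (h : rightPow x i = 0) : rightPow x j = 0 := by
  induction j, hij using Nat.le_induction with
  | base => exact h
  | succ j hj ih => rw [rightPow_succ x (by omega), ih, mul_zero]

/-- The powers of `x` together with `y` and `z` span the `n`-dimensional algebra `A`, and the
products other than those of powers of `x` are governed by `y x = a z`, `x y = b z`,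
`y y = c z`. -/
structure IsQuasiFrame (n : ℕ) (x y z : A) (a b c : ℂ) : Prop where
  yx : y * x = a • z
  xy : x * y = b • z
  yy : y * y = c • z
  xz : x * z = 0
  zx : z * x = 0
  yz : y * z = 0
  zy : z * y = 0
  pow : rightPow x (n - 1) = 0
  span : ⊤ ≤ Submodule.span ℂ (rightPow x '' Set.Icc 1 (n - 2) ∪ {y, z})
  coeff : ¬(a = 0 ∧ b = 0 ∧ c = 0)

namespace IsNaturalGrading

variable {𝒜 : ℕ → Submodule ℂ A} (h : IsNaturalGrading A 𝒜)
include h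

theorem eq_zero_of_mul_eq_zero {k : ℕ} (hk : 1 ≤ k) (hd : Module.finrank ℂ (𝒜 k) = 1)
    (hne : 𝒜 (k + 1) ≠ ⊥) {a : A} (ha : a ∈ 𝒜 k) (hav : ∀ v ∈ 𝒜 1, a * v = 0) : a = 0 := by
  by_contra ha0
  refine hne (eq_bot_iff.2 (h.succ_le_right hk fun b hb v hv => ?_))
  obtain ⟨c, rfl⟩ := Submodule.mem_span_singleton.1
    (le_span_singleton_of_finrank_eq_one hd ha ha0 hb)
  simp [smul_mul_assoc, hav v hv]

theorem finrank_le_one (hd : Module.finrank ℂ (𝒜 1) ≤ 1) [FiniteDimensional ℂ A] {i : ℕ}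
    (hi : 1 ≤ i) : Module.finrank ℂ (𝒜 i) ≤ 1 := by
  obtain ⟨⟨x, hx⟩, hgen⟩ := finrank_le_one_iff.1 hd
  have hx1 : ∀ v ∈ 𝒜 1, ∃ c : ℂ, c • x = v := fun v hv => by
    obtain ⟨c, hc⟩ := hgen ⟨v, hv⟩
    exact ⟨c, congrArg Subtype.val hc⟩
  have key : ∃ w, 𝒜 i ≤ ℂ ∙ w := by
    induction i, hi using Nat.le_induction with
    | base => exact ⟨x, fun v hv => Submodule.mem_span_singleton.2 (hx1 v hv)⟩
    | succ i hi ih =>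
      obtain ⟨w, hw⟩ := ih
      refine ⟨x * w, h.succ_le hi fun v hv a ha => ?_⟩
      obtain ⟨c, rfl⟩ := hx1 v hv
      obtain ⟨d, rfl⟩ := Submodule.mem_span_singleton.1 (hw ha)
      exact Submodule.mem_span_singleton.2 ⟨c * d, by
        rw [smul_mul_assoc, mul_smul_comm, smul_smul]⟩
  obtain ⟨w, hw⟩ := key
  exact (Submodule.finrank_mono hw).trans (finrank_span_singleton_le_one w)

theorem mul_eq_zero_of_forall {y : A} (hl : ∀ v ∈ 𝒜 1, y * v = 0) (hr : ∀ v ∈ 𝒜 1, v * y = 0)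
    (a : A) : y * a = 0 ∧ a * y = 0 := by
  have hl' : ∀ i, 𝒜 i ≤ LinearMap.ker (LinearMap.mulLeft ℂ y) := by
    intro i
    match i with
    | 0 => simp [h.zero]
    | 1 => exact fun v hv => hl v hv
    | i + 2 =>
      refine h.succ_le (by omega) fun v hv a _ => ?_
      simp [← mul_assoc, hl v hv]
  have hr' : ∀ i, 𝒜 i ≤ LinearMap.ker (LinearMap.mulRight ℂ y) := by
    intro i
    match i with
    | 0 => simp [h.zero]
    | 1 => exact fun v hv => hr v hv
    | i + 2 =>
      refine h.succ_le_right (by omega) fun a _ v hv => ?_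
      simp [mul_assoc, hr v hv]
  have ha : a ∈ ⨆ i, 𝒜 i := h.iSup_eq_top ▸ Submodule.mem_top
  exact ⟨iSup_le hl' ha, iSup_le hr' ha⟩

theorem not_nonSplit (hne : 𝒜 2 ≠ ⊥) {y : A} (hy : y ∈ 𝒜 1) (hy0 : y ≠ 0)
    (hl : ∀ v ∈ 𝒜 1, y * v = 0) (hr : ∀ v ∈ 𝒜 1, v * y = 0) : ¬NonSplit A := by
  obtain ⟨f, hfy, hf⟩ := Submodule.exists_le_ker_of_notMem (h.notMem_tail_two hy hy0)
  refine not_not.2 ⟨ℂ ∙ y, LinearMap.ker f, ?_, ?_, ?_, ?_, ?_, ?_⟩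
  · intro a x hx
    obtain ⟨c, rfl⟩ := Submodule.mem_span_singleton.1 hx
    obtain ⟨h1, h2⟩ := h.mul_eq_zero_of_forall hl hr a
    simp [smul_mul_assoc, mul_smul_comm, h1, h2]
  · exact fun a x _ => ⟨hf (h.mul_mem_tail_two a x), hf (h.mul_mem_tail_two x a)⟩
  · simpa using hy0
  · intro hbot
    refine hne (eq_bot_iff.2 (le_trans ?_ hbot.le))
    exact le_trans (le_iSup₂ (f := fun i (_ : 2 ≤ i) => 𝒜 i) 2 le_rfl) hf
  · rw [eq_bot_iff]
    rintro x ⟨hx, hxf⟩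
    obtain ⟨c, rfl⟩ := Submodule.mem_span_singleton.1 hx
    have : c = 0 := by simpa [hfy] using hxf
    simp [this]
  · rw [eq_top_iff]
    intro x _
    rw [← sub_add_cancel x ((f x / f y) • y), add_comm]
    refine Submodule.add_mem_sup (Submodule.mem_span_singleton.2 ⟨_, rfl⟩) ?_
    simp [hfy]

theorem not_nonSplit_of_finrank_two_three [FiniteDimensional ℂ A]
    (h1 : 1 < Module.finrank ℂ (𝒜 1)) (h2 : Module.finrank ℂ (𝒜 2) = 1)
    (h3 : Module.finrank ℂ (𝒜 3) = 1) : ¬NonSplit A := by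
  have hne2 : 𝒜 2 ≠ ⊥ := fun hb => by rw [hb, finrank_bot] at h2; omega
  have hne3 : 𝒜 3 ≠ ⊥ := fun hb => by rw [hb, finrank_bot] at h3; omega
  have cancel {a : A} (ha : a ∈ 𝒜 2) (hav : ∀ v ∈ 𝒜 1, a * v = 0) : a = 0 :=
    h.eq_zero_of_mul_eq_zero (by norm_num) h2 hne3 ha hav
  obtain ⟨w, hw, hw0⟩ := Submodule.exists_mem_ne_zero_of_ne_bot hne2
  obtain ⟨y, hy, hy0, hyw⟩ := exists_ne_zero_map_eq_zero (S := 𝒜 1) (T := 𝒜 3)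
    (LinearMap.mulRight ℂ w) (fun v hv => h.mul_mem le_rfl (by norm_num) hv hw) (by omega)
  have hy2 : ∀ p ∈ 𝒜 2, y * p = 0 := by
    intro p hp
    obtain ⟨c, rfl⟩ := Submodule.mem_span_singleton.1
      (le_span_singleton_of_finrank_eq_one h2 hw hw0 hp)
    rw [LinearMap.mulRight_apply] at hyw
    rw [mul_smul_comm, hyw, smul_zero]
  have hyl : ∀ v ∈ 𝒜 1, y * v = 0 := fun v hv =>
    cancel (h.mul_mem le_rfl le_rfl hy hv) fun u hu => by
      rw [mul_assoc, hy2 _ (h.mul_mem le_rfl le_rfl hv hu)]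
  refine h.not_nonSplit hne2 hy hy0 hyl fun v hv =>
    cancel (h.mul_mem le_rfl le_rfl hv hy) fun u hu => ?_
  rw [mul_assoc, hyl u hu, mul_zero]

theorem finrank_three_lt [FiniteDimensional ℂ A] (h1 : 1 < Module.finrank ℂ (𝒜 1))
    (h2 : Module.finrank ℂ (𝒜 2) = 1) :
    Module.finrank ℂ (𝒜 3) < Module.finrank ℂ (𝒜 1) := by
  by_contra! hlt
  have hne2 : 𝒜 2 ≠ ⊥ := fun hb => by rw [hb, finrank_bot] at h2; omega
  obtain ⟨w, hw, hw0⟩ := Submodule.exists_mem_ne_zero_of_ne_bot hne2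
  have hspan := le_span_singleton_of_finrank_eq_one h2 hw hw0
  have hle : 𝒜 3 ≤ (𝒜 1).map (LinearMap.mulRight ℂ w) := by
    refine h.succ_le (by norm_num) fun v hv p hp => ?_
    obtain ⟨c, rfl⟩ := Submodule.mem_span_singleton.1 (hspan hp)
    exact ⟨c • v, Submodule.smul_mem _ c hv, by simp [mul_smul_comm]⟩
  -- right multiplication by `w` is injective on `𝒜 1` by counting dimensions
  have hinj : ∀ u ∈ 𝒜 1, u * w = 0 → u = 0 := by
    intro u hu huw
    set f := (LinearMap.mulRight ℂ w).domRestrict (𝒜 1) with hf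
    have hr : (𝒜 1).map (LinearMap.mulRight ℂ w) = LinearMap.range f := by
      rw [hf, LinearMap.range_domRestrict]
    have hrank := LinearMap.finrank_range_add_finrank_ker f
    have hle' := Submodule.finrank_mono hle
    rw [hr] at hle'
    have hk : LinearMap.ker f = ⊥ := Submodule.finrank_eq_zero.1 (by omega)
    have : (⟨u, hu⟩ : 𝒜 1) ∈ LinearMap.ker f := by simpa [hf] using huw
    rw [hk] at this
    simpa using this
  have hstep : ∀ u ∈ 𝒜 1, u ≠ 0 → ∀ p ∈ 𝒜 2, u * p = 0 → p = 0 := by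
    intro u hu hu0 p hp hup
    obtain ⟨c, rfl⟩ := Submodule.mem_span_singleton.1 (hspan hp)
    rw [mul_smul_comm, smul_eq_zero] at hup
    rcases hup with rfl | hup
    · simp
    · exact absurd (hinj u hu hup) hu0
  have hne1 : 𝒜 1 ≠ ⊥ := fun hb => by rw [hb, finrank_bot] at h1; omega
  obtain ⟨u, hu, hu0⟩ := Submodule.exists_mem_ne_zero_of_ne_bot hne1
  obtain ⟨v, hv, hv0, huv⟩ := exists_ne_zero_map_eq_zero (S := 𝒜 1) (T := 𝒜 2)
    (LinearMap.mulLeft ℂ u) (fun v hv => h.mul_mem le_rfl le_rfl hu hv) (by omega)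
  rw [LinearMap.mulLeft_apply] at huv
  have hvz : ∀ z ∈ 𝒜 1, v * z = 0 := fun z hz =>
    hstep u hu hu0 _ (h.mul_mem le_rfl le_rfl hv hz) (by rw [← mul_assoc, huv, zero_mul])
  refine hne2 (eq_bot_iff.2 (h.succ_le le_rfl fun t ht z hz => ?_))
  exact hstep v hv hv0 _ (h.mul_mem le_rfl le_rfl ht hz) (by
    rw [← mul_assoc, hvz t ht, zero_mul])

theorem exists_isQuasiFrame [FiniteDimensional ℂ A] {n : ℕ} (hn : 5 < n)
    (hne : ∀ i, 1 ≤ i → i ≤ n - 2 → 𝒜 i ≠ ⊥) (hbot : ∀ i, n - 1 ≤ i → 𝒜 i = ⊥)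
    (h1 : Module.finrank ℂ (𝒜 1) = 2) (h2 : Module.finrank ℂ (𝒜 2) = 2)
    (h3 : Module.finrank ℂ (𝒜 3) = 1) (h4 : Module.finrank ℂ (𝒜 4) = 1) :
    ∃ (x y z : A) (a b c : ℂ), IsQuasiFrame n x y z a b c := by
  have hne3 : 𝒜 3 ≠ ⊥ := hne 3 (by norm_num) (by omega)
  have hne4 : 𝒜 4 ≠ ⊥ := hne 4 (by norm_num) (by omega)
  have m11 {u v : A} (hu : u ∈ 𝒜 1) (hv : v ∈ 𝒜 1) : u * v ∈ 𝒜 2 := h.mul_mem le_rfl le_rfl hu hv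
  have m12 {u v : A} (hu : u ∈ 𝒜 1) (hv : v ∈ 𝒜 2) : u * v ∈ 𝒜 3 :=
    h.mul_mem le_rfl (by norm_num) hu hv
  have cancel {a : A} (ha : a ∈ 𝒜 3) (hav : ∀ v ∈ 𝒜 1, a * v = 0) : a = 0 :=
    h.eq_zero_of_mul_eq_zero (by norm_num) h3 hne4 ha hav
  obtain ⟨w, hw, hw0⟩ := Submodule.exists_mem_ne_zero_of_ne_bot hne3
  obtain ⟨y, hy, hy0, hyw⟩ := exists_ne_zero_map_eq_zero (S := 𝒜 1) (T := 𝒜 4)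
    (LinearMap.mulRight ℂ w) (fun v hv => h.mul_mem le_rfl (by norm_num) hv hw) (by omega)
  have hy3 : ∀ p ∈ 𝒜 3, y * p = 0 := by
    intro p hp
    obtain ⟨c, rfl⟩ := Submodule.mem_span_singleton.1
      (le_span_singleton_of_finrank_eq_one h3 hw hw0 hp)
    rw [LinearMap.mulRight_apply] at hyw
    rw [mul_smul_comm, hyw, smul_zero]
  have hy2 : ∀ p ∈ 𝒜 2, y * p = 0 := fun p hp =>
    cancel (m12 hy hp) fun v hv => by
      rw [mul_assoc, hy3 _ (h.mul_mem (by norm_num) le_rfl hp hv)]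
  have hvyu : ∀ v ∈ 𝒜 1, ∀ u ∈ 𝒜 1, v * (y * u) = 0 := fun v hv u hu =>
    cancel (m12 hv (m11 hy hu)) fun t ht => by
      rw [mul_assoc, mul_assoc, hy2 _ (m11 hu ht), mul_zero]
  have hvuy : ∀ v ∈ 𝒜 1, ∀ u ∈ 𝒜 1, v * (u * y) = 0 := fun v hv u hu =>
    cancel (m12 hv (m11 hu hy)) fun t ht => by
      rw [mul_assoc, mul_assoc, hvyu u hu t ht, mul_zero]
  obtain ⟨x, hx, hxy⟩ : ∃ x ∈ 𝒜 1, x ∉ ℂ ∙ y := by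
    by_contra! hall
    have := (Submodule.finrank_mono hall).trans (finrank_span_singleton_le_one y)
    omega
  have hV : ∀ v ∈ 𝒜 1, ∃ p q : ℂ, v = p • x + q • y := by
    have heq : Submodule.span ℂ {x, y} = 𝒜 1 :=
      span_pair_eq_of_finrank_eq_two h1 hx hy hy0 fun c hc =>
        hxy (Submodule.mem_span_singleton.2 ⟨c, hc⟩)
    intro v hv
    rw [← heq, Submodule.mem_span_pair] at hv
    obtain ⟨p, q, hpq⟩ := hv
    exact ⟨p, q, hpq.symm⟩
  have hprod {K : Submodule ℂ A} (hxx : x * x ∈ K) (hxy : x * y ∈ K) (hyx : y * x ∈ K)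
      (hyy : y * y ∈ K) : 𝒜 2 ≤ K := by
    refine h.succ_le le_rfl fun u hu v hv => ?_
    obtain ⟨p, q, rfl⟩ := hV u hu
    obtain ⟨r, s, rfl⟩ := hV v hv
    simp only [add_mul, mul_add, smul_mul_assoc, mul_smul_comm, smul_add]
    exact add_mem (add_mem (K.smul_mem _ (K.smul_mem _ hxx)) (K.smul_mem _ (K.smul_mem _ hyx)))
      (add_mem (K.smul_mem _ (K.smul_mem _ hxy)) (K.smul_mem _ (K.smul_mem _ hyy)))
  have hxxx : x * (x * x) ≠ 0 := by
    intro h0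
    have hle : 𝒜 2 ≤ LinearMap.ker (LinearMap.mulLeft ℂ x) := by
      refine hprod h0 (hvuy x hx x hx) (hvyu x hx x hx) (hvyu x hx y hy)
    refine hne3 (eq_bot_iff.2 (h.succ_le (by norm_num) fun u hu v hv => ?_))
    obtain ⟨p, q, rfl⟩ := hV u hu
    have hxv : x * v = 0 := hle hv
    simp [add_mul, smul_mul_assoc, hxv, hy2 v hv]
  obtain ⟨z, hz, hz0, hxz⟩ := exists_ne_zero_map_eq_zero (S := 𝒜 2) (T := 𝒜 3)
    (LinearMap.mulLeft ℂ x) (fun v hv => m12 hx hv) (by omega)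
  rw [LinearMap.mulLeft_apply] at hxz
  have hW : Submodule.span ℂ {x * x, z} = 𝒜 2 := by
    refine span_pair_eq_of_finrank_eq_two h2 (m11 hx hx) hz hz0 fun c hc => hxxx ?_
    rw [← hc, mul_smul_comm, hxz, smul_zero]
  have hmul : ∀ p ∈ 𝒜 2, x * p = 0 → ∃ c : ℂ, p = c • z := by
    intro p hp hxp
    rw [← hW, Submodule.mem_span_pair] at hp
    obtain ⟨r, s, rfl⟩ := hp
    rw [mul_add, mul_smul_comm, mul_smul_comm, hxz, smul_zero, add_zero, smul_eq_zero] at hxp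
    obtain rfl := hxp.resolve_right hxxx
    exact ⟨s, by simp⟩
  obtain ⟨a, hyx'⟩ := hmul _ (m11 hy hx) (hvyu x hx x hx)
  obtain ⟨b, hxy'⟩ := hmul _ (m11 hx hy) (hvuy x hx x hx)
  obtain ⟨c, hyy'⟩ := hmul _ (m11 hy hy) (hvyu x hx y hy)
  have hcoeff : ¬(a = 0 ∧ b = 0 ∧ c = 0) := by
    rintro ⟨rfl, rfl, rfl⟩
    have hle : 𝒜 2 ≤ ℂ ∙ (x * x) := by
      refine hprod (Submodule.mem_span_singleton_self _) ?_ ?_ ?_ <;> simp [hyx', hxy', hyy']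
    have := (Submodule.finrank_mono hle).trans (finrank_span_singleton_le_one _)
    omega
  have hzr : ∀ v ∈ 𝒜 1, z * v = 0 := by
    have key {p : A} (hp : ∀ v ∈ 𝒜 1, p * v = 0) {d : ℂ} (hd : p = d • z) (hd0 : d ≠ 0) :
        ∀ v ∈ 𝒜 1, z * v = 0 := by
      intro v hv
      have := hp v hv
      rw [hd, smul_mul_assoc, smul_eq_zero] at this
      exact this.resolve_left hd0
    by_cases ha : a = 0
    · by_cases hb : b = 0
      · exact key (fun v hv => by rw [mul_assoc, hy2 _ (m11 hy hv)]) hyy'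
          fun hc => hcoeff ⟨ha, hb, hc⟩
      · exact key (fun v hv => by rw [mul_assoc, hvyu x hx v hv]) hxy' hb
    · exact key (fun v hv => by rw [mul_assoc, hy2 _ (m11 hx hv)]) hyx' ha
  have hpow : ∀ i, 3 ≤ i → 𝒜 i ≤ ℂ ∙ rightPow x i := by
    intro i hi
    induction i, hi using Nat.le_induction with
    | base => exact le_span_singleton_of_finrank_eq_one h3 (m12 hx (m11 hx hx)) hxxx
    | succ i hi ih =>
      refine h.succ_le (by omega) fun u hu v hv => ?_
      obtain ⟨p, q, rfl⟩ := hV u hu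
      obtain ⟨r, rfl⟩ := Submodule.mem_span_singleton.1 (ih hv)
      have hyp : y * rightPow x i = 0 := by
        obtain ⟨j, rfl⟩ : ∃ j, i = 1 + 1 + j := ⟨i - 2, by omega⟩
        rw [← rightPow_mul x (by norm_num) (by omega), ← mul_assoc,
          ← rightPow_mul x le_rfl le_rfl, rightPow_one, hy2 _ (m11 hx hx), zero_mul]
      rw [rightPow_succ x (by omega), add_mul, smul_mul_assoc, smul_mul_assoc, mul_smul_comm,
        mul_smul_comm, hyp, smul_zero, smul_zero, add_zero, smul_smul]
      exact Submodule.mem_span_singleton.2 ⟨_, rfl⟩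
  have hmem : ∀ i, 1 ≤ i → rightPow x i ∈ 𝒜 i := by
    intro i hi
    induction i, hi using Nat.le_induction with
    | base => exact hx
    | succ i hi ih =>
      rw [rightPow_succ x hi, add_comm]
      exact h.mul_mem le_rfl hi hx ih
  refine ⟨x, y, z, a, b, c, hyx', hxy', hyy', hxz, hzr x hx, hy2 z hz, hzr y hy, ?_, ?_, hcoeff⟩
  · have := hmem (n - 1) (by omega)
    rwa [hbot _ le_rfl, Submodule.mem_bot] at this
  · rw [← h.iSup_eq_top]
    have hsub {i : ℕ} (hi : 1 ≤ i) (hi' : i ≤ n - 2) : rightPow x i ∈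
        Submodule.span ℂ (rightPow x '' Set.Icc 1 (n - 2) ∪ {y, z}) :=
      Submodule.subset_span (Or.inl ⟨i, ⟨hi, hi'⟩, rfl⟩)
    refine iSup_le fun i => ?_
    match i with
    | 0 => simp [h.zero]
    | 1 =>
      intro v hv
      obtain ⟨p, q, rfl⟩ := hV v hv
      exact add_mem (Submodule.smul_mem _ _ (hsub (i := 1) le_rfl (by omega)))
        (Submodule.smul_mem _ _ (Submodule.subset_span (by simp)))
    | 2 =>
      rw [← hW, Submodule.span_le]
      rintro _ (rfl | rfl)
      · exact hsub (i := 2) (by norm_num) (by omega)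
      · exact Submodule.subset_span (by simp)
    | i + 3 =>
      rcases le_or_gt (i + 3) (n - 2) with hi | hi
      · refine (hpow _ (by omega)).trans ?_
        rw [Submodule.span_singleton_le_iff_mem]
        exact hsub (by omega) hi
      · simp [hbot (i + 3) (by omega)]

theorem exists_isQuasiFrame_of_nonSplit [FiniteDimensional ℂ A] {n : ℕ} (hn : 5 < n)
    (hdim : Module.finrank ℂ A = n) (hns : NonSplit A)
    (hqf₁ : algPow A (n - 2) ≠ ⊥) (hqf₂ : algPow A (n - 1) = ⊥) :
    ∃ (x y z : A) (a b c : ℂ), IsQuasiFrame n x y z a b c := by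
  have hne : ∀ i, 1 ≤ i → i ≤ n - 2 → 𝒜 i ≠ ⊥ := fun i hi hi' => h.ne_bot hi hi' hqf₁
  have hbot : ∀ i, n - 1 ≤ i → 𝒜 i = ⊥ := fun i hi =>
    h.eq_bot_of_le (by omega) hi (eq_bot_iff.2 ((h.le_algPow (by omega)).trans hqf₂.le))
  have hpos : ∀ i, 1 ≤ i → i ≤ n - 2 → 1 ≤ Module.finrank ℂ (𝒜 i) := fun i hi hi' =>
    Submodule.one_le_finrank_iff.2 (hne i hi hi')
  have hsum := h.sum_finrank hbot
  rw [hdim] at hsum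
  have h0 : Module.finrank ℂ (𝒜 0) = 0 := by simp [h.zero]
  have h1 : 1 < Module.finrank ℂ (𝒜 1) := by
    by_contra! hle
    obtain ⟨m, rfl⟩ : ∃ m, n = m + 2 := ⟨n - 2, by omega⟩
    rw [show m + 2 - 1 = m + 1 by omega, Finset.sum_range_succ', h0] at hsum
    have := Finset.sum_le_card_nsmul (Finset.range m) (fun i => Module.finrank ℂ (𝒜 (i + 1))) 1
      fun i _ => h.finrank_le_one hle (by omega)
    simp only [Finset.card_range, smul_eq_mul] at this
    omega
  have hsmall : Module.finrank ℂ (𝒜 1) + Module.finrank ℂ (𝒜 2) + Module.finrank ℂ (𝒜 3) +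
      Module.finrank ℂ (𝒜 4) ≤ 6 := by
    obtain ⟨m, rfl⟩ : ∃ m, n = m + 6 := ⟨n - 6, by omega⟩
    rw [show m + 6 - 1 = 5 + m by omega, Finset.sum_range_add] at hsum
    simp only [Finset.sum_range_succ, Finset.sum_range_zero, h0] at hsum
    have := Finset.card_nsmul_le_sum (Finset.range m) (fun i => Module.finrank ℂ (𝒜 (5 + i))) 1
      fun i hi => hpos _ (by omega) (by have := Finset.mem_range.1 hi; omega)
    simp only [Finset.card_range, smul_eq_mul] at this
    omega
  have p2 := hpos 2 (by omega) (by omega)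
  have p3 := hpos 3 (by omega) (by omega)
  have p4 := hpos 4 (by omega) (by omega)
  by_cases h2 : Module.finrank ℂ (𝒜 2) = 1
  · by_cases h3 : Module.finrank ℂ (𝒜 3) = 1
    · exact absurd hns (h.not_nonSplit_of_finrank_two_three h1 h2 h3)
    · have := h.finrank_three_lt h1 h2
      omega
  · exact h.exists_isQuasiFrame hn hne hbot (by omega) (by omega) (by omega) (by omega)

end IsNaturalGrading

end

section

variable {A}

namespace IsQuasiFrame

variable {n : ℕ} {x y z : A} {a b c : ℂ} (h : IsQuasiFrame n x y z a b c)
include h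

theorem zz : z * z = 0 := by
  have key {u v : A} {d : ℂ} (hd : u * v = d • z) (hv : v * z = 0) (hd0 : d ≠ 0) : z * z = 0 := by
    have : d • (z * z) = 0 := by rw [← smul_mul_assoc, ← hd, mul_assoc, hv, mul_zero]
    exact (smul_eq_zero.1 this).resolve_left hd0
  by_cases ha : a = 0
  · by_cases hb : b = 0
    · exact key h.yy h.yz fun hc => h.coeff ⟨ha, hb, hc⟩
    · exact key h.xy h.yz hb
  · exact key h.yx h.xz ha

theorem rightPow_mul_y {i : ℕ} (hi : 2 ≤ i) : rightPow x i * y = 0 := by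
  obtain ⟨i, rfl⟩ := Nat.exists_eq_add_of_le' hi
  rw [show i + 2 = i + 1 + 1 from rfl, ← rightPow_mul x (by omega) le_rfl, rightPow_one,
    mul_assoc, h.xy, mul_smul_comm]
  induction i with
  | zero => simp [h.xz]
  | succ i ih => rw [rightPow_succ x (by omega), mul_assoc, ← mul_smul_comm, ih (by omega), mul_zero]

theorem y_mul_rightPow {i : ℕ} (hi : 2 ≤ i) : y * rightPow x i = 0 := by
  obtain ⟨i, rfl⟩ := Nat.exists_eq_add_of_le' hi
  rw [show i + 2 = i + 1 + 1 from rfl, rightPow_succ x (by omega), ← mul_assoc, h.yx,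
    smul_mul_assoc]
  match i with
  | 0 => simp [h.zx]
  | i + 1 => rw [rightPow_succ x (by omega), ← mul_assoc, h.zx, zero_mul, smul_zero]

theorem rightPow_mul_z {i : ℕ} (hi : 1 ≤ i) : rightPow x i * z = 0 := by
  induction i, hi using Nat.le_induction with
  | base => exact h.xz
  | succ i hi ih => rw [rightPow_succ x hi, mul_assoc, ih, mul_zero]

theorem z_mul_rightPow {i : ℕ} (hi : 1 ≤ i) : z * rightPow x i = 0 := by
  induction i, hi using Nat.le_induction with
  | base => exact h.zx
  | succ i hi ih => rw [rightPow_succ x hi, ← mul_assoc, h.zx, zero_mul]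

/-- Replacing `x, y, z` by `x + q y, r y, s z`. -/
theorem change (hn : 5 < n) {q r s a' b' c' : ℂ} (hr : r ≠ 0) (hs : s ≠ 0)
    (ha : s * a' = r * (a + q * c)) (hb : s * b' = r * (b + q * c)) (hc : s * c' = r ^ 2 * c) :
    IsQuasiFrame n (x + q • y) (r • y) (s • z) a' b' c' := by
  have hsq : (x + q • y) * (x + q • y) = x * x + (q * (a + b) + q ^ 2 * c) • z := by
    simp only [add_mul, mul_add, smul_mul_assoc, mul_smul_comm, h.yx, h.xy, h.yy]
    module
  have hpow : ∀ i, 3 ≤ i → rightPow (x + q • y) i = rightPow x i := by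
    intro i hi
    induction i, hi using Nat.le_induction with
    | base =>
      have hyxx := h.y_mul_rightPow (i := 2) le_rfl
      simp only [rightPow] at hyxx ⊢
      rw [hsq]
      simp [add_mul, mul_add, smul_mul_assoc, mul_smul_comm, h.xz, h.yz, hyxx]
    | succ i hi ih =>
      rw [rightPow_succ _ (by omega), ih, rightPow_succ _ (by omega), add_mul, smul_mul_assoc,
        h.y_mul_rightPow (by omega), smul_zero, add_zero]
  refine ⟨?_, ?_, ?_, ?_, ?_, ?_, ?_, ?_, ?_, ?_⟩
  · simp only [mul_add, smul_mul_assoc, mul_smul_comm, h.yx, h.yy, smul_smul]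
    rw [mul_comm a' s, ha]
    module
  · simp only [add_mul, smul_mul_assoc, mul_smul_comm, h.xy, h.yy, smul_smul]
    rw [mul_comm b' s, hb]
    module
  · simp only [smul_mul_assoc, mul_smul_comm, h.yy, smul_smul]
    rw [mul_comm c' s, hc]
    module
  · simp [add_mul, smul_mul_assoc, mul_smul_comm, h.xz, h.yz]
  · simp [mul_add, smul_mul_assoc, mul_smul_comm, h.zx, h.zy]
  · simp [smul_mul_assoc, mul_smul_comm, h.yz]
  · simp [smul_mul_assoc, mul_smul_comm, h.zy]
  · rw [hpow _ (by omega), h.pow]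
  · refine h.span.trans (Submodule.span_le.2 ?_)
    set S := Submodule.span ℂ (rightPow (x + q • y) '' Set.Icc 1 (n - 2) ∪ {r • y, s • z})
    have hp {i : ℕ} (hi : 1 ≤ i) (hi' : i ≤ n - 2) : rightPow (x + q • y) i ∈ S :=
      Submodule.subset_span (Or.inl ⟨i, ⟨hi, hi'⟩, rfl⟩)
    have hy : y ∈ S := (S.smul_mem_iff hr).1 (Submodule.subset_span (by simp))
    have hz : z ∈ S := (S.smul_mem_iff hs).1 (Submodule.subset_span (by simp))
    rintro _ (⟨i, ⟨hi, hi'⟩, rfl⟩ | rfl | rfl)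
    · match i with
      | 1 =>
        have := sub_mem (hp (i := 1) le_rfl (by omega)) (S.smul_mem q hy)
        simpa using this
      | 2 =>
        have := sub_mem (hp (i := 2) (by omega) (by omega))
          (S.smul_mem (q * (a + b) + q ^ 2 * c) hz)
        simpa [rightPow, hsq] using this
      | i + 3 =>
        rw [SetLike.mem_coe, ← hpow (i + 3) (by omega)]
        exact hp hi hi'
    · exact hy
    · exact hz
  · rintro ⟨rfl, rfl, rfl⟩
    have hc0 : c = 0 := by simpa [hr] using hc
    subst hc0
    exact h.coeff ⟨by simpa [hr] using ha, by simpa [hr] using hb, rfl⟩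

theorem exists_table [FiniteDimensional ℂ A] (hn : 5 < n) (hdim : Module.finrank ℂ A = n)
    {t : Fin 3 ⊕ ℂ} (ht : quasiCoeff t = (a, b, c)) :
    ∃ e : ℕ → A, IsBasisFam A n e ∧ QuasiFiliformTable A n t e := by
  set e : ℕ → A := fun i => if i ≤ n - 2 then rightPow x i else if i = n - 1 then y else z with he
  have e_le {i : ℕ} (hi : i ≤ n - 2) : e i = rightPow x i := by simp [he, hi]
  have e_y : e (n - 1) = y := by
    simp [he, show ¬(n - 1 ≤ n - 2) by omega]
  have e_z : e n = z := by
    simp [he, show ¬(n ≤ n - 2) by omega, show ¬(n = n - 1) by omega]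
  have hspan : Submodule.span ℂ (Set.range fun i : Fin n => e (i.1 + 1)) = ⊤ := by
    rw [← top_le_iff]
    refine h.span.trans (Submodule.span_mono ?_)
    rintro _ (⟨i, ⟨hi, hi'⟩, rfl⟩ | rfl | rfl)
    · exact ⟨⟨i - 1, by omega⟩, by simp [Nat.sub_add_cancel hi, e_le hi']⟩
    · exact ⟨⟨n - 2, by omega⟩, by simpa [show n - 2 + 1 = n - 1 by omega] using e_y⟩
    · exact ⟨⟨n - 1, by omega⟩, by simpa [show n - 1 + 1 = n by omega] using e_z⟩
  refine ⟨e, ⟨linearIndependent_of_top_le_span_of_card_eq_finrank hspan.ge (by simp [hdim]),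
    hspan⟩, ?_⟩
  intro i j hi hin hj hjn
  rw [ht]
  have hcases : ∀ k ≤ n, k ≤ n - 2 ∨ k = n - 1 ∨ k = n := fun k hk => by omega
  rcases hcases i hin with hi' | rfl | rfl
  · rcases hcases j hjn with hj' | rfl | rfl
    · rw [e_le hi', e_le hj', rightPow_mul x hi hj]
      by_cases hij : i + j ≤ n - 2
      · simp [e_le hij, hij, show 2 ≤ i + j by omega, show i ≠ n - 1 by omega,
          show j ≠ n - 1 by omega]
      · simp [hij, show i ≠ n - 1 by omega, show j ≠ n - 1 by omega,
          rightPow_eq_zero_of_le (by omega) (show n - 1 ≤ i + j by omega) h.pow]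
    · rw [e_le hi', e_y, e_z]
      by_cases hi1 : i = 1
      · subst hi1
        simp [h.xy, show ¬(1 + (n - 1) ≤ n - 2) by omega, show (1 : ℕ) ≠ n - 1 by omega]
      · simp [hi1, h.rightPow_mul_y (show 2 ≤ i by omega), show i ≠ n - 1 by omega,
          show ¬(i + (n - 1) ≤ n - 2) by omega]
    · rw [e_le hi', e_z, h.rightPow_mul_z hi]
      simp [show ¬(i + j ≤ j - 2) by omega, show j ≠ j - 1 by omega, show j ≠ 1 by omega]
  · rcases hcases j hjn with hj' | rfl | rfl
    · rw [e_le hj', e_y, e_z]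
      by_cases hj1 : j = 1
      · subst hj1
        simp [h.yx, show ¬(n - 1 + 1 ≤ n - 2) by omega, show (1 : ℕ) ≠ n - 1 by omega]
      · simp [hj1, h.y_mul_rightPow (show 2 ≤ j by omega), show j ≠ n - 1 by omega,
          show ¬(n - 1 + j ≤ n - 2) by omega]
    · rw [e_y, e_z, h.yy]
      simp [show ¬(n - 1 + (n - 1) ≤ n - 2) by omega, show n - 1 ≠ 1 by omega]
    · rw [e_y, e_z, h.yz]
      simp [show ¬(j - 1 + j ≤ j - 2) by omega, show j ≠ j - 1 by omega, show j ≠ 1 by omega]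
  · rcases hcases j hjn with hj' | rfl | rfl
    · rw [e_le hj', e_z, h.z_mul_rightPow hj]
      simp [show ¬(i + j ≤ i - 2) by omega, show i ≠ i - 1 by omega, show i ≠ 1 by omega]
    · rw [e_y, e_z, h.zy]
      simp [show ¬(i + (i - 1) ≤ i - 2) by omega, show i ≠ i - 1 by omega, show i ≠ 1 by omega]
    · rw [e_z, h.zz]
      simp [show ¬(j + j ≤ j - 2) by omega, show j ≠ j - 1 by omega, show j ≠ 1 by omega]

theorem exists_normal_form [FiniteDimensional ℂ A] (hn : 5 < n) (hdim : Module.finrank ℂ A = n) :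
    ∃ (t : Fin 3 ⊕ ℂ) (e : ℕ → A), IsBasisFam A n e ∧ QuasiFiliformTable A n t e := by
  by_cases hc : c = 0
  · subst hc
    by_cases hb : b = 0
    · subst hb
      have ha : a ≠ 0 := fun ha => h.coeff ⟨ha, rfl, rfl⟩
      exact ⟨Sum.inl 0, (h.change hn (q := 0) (r := 1) (s := a) (a' := 1) (b' := 0) (c' := 0)
        one_ne_zero ha (by ring) (by ring) (by ring)).exists_table hn hdim rfl⟩
    · exact ⟨Sum.inr (a / b), (h.change hn (q := 0) (r := 1) (s := b) (a' := a / b) (b' := 1)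
        (c' := 0) one_ne_zero hb (by field_simp; ring) (by ring) (by ring)).exists_table hn hdim
        rfl⟩
  · by_cases hab : a = b
    · subst hab
      exact ⟨Sum.inl 1, (h.change hn (q := (c - a) / c) (r := 1) (s := c) (a' := 1) (b' := 1)
        (c' := 1) one_ne_zero hc (by field_simp; ring) (by field_simp; ring)
        (by ring)).exists_table hn hdim rfl⟩
    · have hba : b - a ≠ 0 := sub_ne_zero.2 (Ne.symm hab)
      exact ⟨Sum.inl 2, (h.change hn (q := -a / c) (r := (b - a) / c) (s := (b - a) ^ 2 / c)
        (a' := 0) (b' := 1) (c' := 1) (div_ne_zero hba hc) (div_ne_zero (pow_ne_zero 2 hba) hc)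
        (by field_simp; ring) (by field_simp; ring) (by field_simp)).exists_table hn hdim
        rfl⟩

end IsQuasiFrame

namespace IsBasisFam

variable {n : ℕ} {e : ℕ → A} (he : IsBasisFam A n e)

/-- The basis of `A` given by `e 1, …, e n`, indexed from `0`. -/
noncomputable def basis : Module.Basis (Fin n) ℂ A :=
  Module.Basis.mk he.1 he.2.ge

/-- The `k`-th coordinate with respect to `e 1, …, e n` (zero unless `1 ≤ k ≤ n`). -/
noncomputable def coord (k : ℕ) : A →ₗ[ℂ] ℂ :=
  if hk : k - 1 < n then he.basis.coord ⟨k - 1, hk⟩ else 0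

theorem coord_apply {k l : ℕ} (hk : 1 ≤ k) (hkn : k ≤ n) (hl : 1 ≤ l) (hln : l ≤ n) :
    he.coord k (e l) = if l = k then 1 else 0 := by
  have hb : e l = he.basis ⟨l - 1, by omega⟩ := by
    simp [basis, Nat.sub_add_cancel hl]
  rw [coord, dif_pos (by omega), hb, Module.Basis.coord_apply, Module.Basis.repr_self,
    Finsupp.single_apply]
  simp only [Fin.mk.injEq]
  congr 1
  exact propext ⟨fun h => by omega, fun h => by omega⟩

include he in
theorem induction {p : A → Prop} (h0 : p 0) (hadd : ∀ u v, p u → p v → p (u + v))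
    (hsmul : ∀ (c : ℂ) u, p u → p (c • u)) (hbase : ∀ i, 1 ≤ i → i ≤ n → p (e i)) (u : A) :
    p u := by
  have hu : u ∈ Submodule.span ℂ (Set.range fun i : Fin n => e (i.1 + 1)) :=
    he.2 ▸ Submodule.mem_top
  induction hu using Submodule.span_induction with
  | mem v hv =>
    obtain ⟨i, rfl⟩ := hv
    exact hbase _ (by omega) (by omega)
  | zero => exact h0
  | add u v _ _ hu hv => exact hadd u v hu hv
  | smul c u _ hu => exact hsmul c u hu

/-- Bilinear maps agreeing on pairs of basis vectors agree. -/
theorem ext_bilin {V : Type*} [AddCommGroup V] [Module ℂ V] {f g : A →ₗ[ℂ] A →ₗ[ℂ] V}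
    (he : IsBasisFam A n e)
    (h : ∀ i j, 1 ≤ i → i ≤ n → 1 ≤ j → j ≤ n → f (e i) (e j) = g (e i) (e j)) (u v : A) :
    f u v = g u v := by
  refine he.induction (p := fun u => f u v = g u v) (by simp) (fun u u' hu hu' => by simp [hu, hu'])
    (fun c u hu => by simp [hu]) (fun i hi hin => ?_) u
  exact he.induction (p := fun v => f (e i) v = g (e i) v) (by simp)
    (fun u u' hu hu' => by simp [hu, hu']) (fun c u hu => by simp [hu])
    (fun j hj hjn => h i j hi hin hj hjn) v

variable {t : Fin 3 ⊕ ℂ} (ht : QuasiFiliformTable A n t e)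
include ht

theorem coord_mul_basis {k i j : ℕ} (hk : 1 ≤ k) (hkn : k ≤ n) (hi : 1 ≤ i) (hin : i ≤ n)
    (hj : 1 ≤ j) (hjn : j ≤ n) :
    he.coord k (e i * e j) =
      (if i + j = k ∧ k ≤ n - 2 then 1 else 0) +
      (if i = n - 1 ∧ j = 1 ∧ k = n then (quasiCoeff t).1 else 0) +
      (if i = 1 ∧ j = n - 1 ∧ k = n then (quasiCoeff t).2.1 else 0) +
      (if i = n - 1 ∧ j = n - 1 ∧ k = n then (quasiCoeff t).2.2 else 0) := by
  have hn : he.coord k (e n) = if k = n then 1 else 0 := by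
    rw [he.coord_apply hk hkn (by omega) le_rfl]
    exact if_congr eq_comm rfl rfl
  have hij : he.coord k (if 2 ≤ i + j ∧ i + j ≤ n - 2 then e (i + j) else 0) =
      if i + j = k ∧ k ≤ n - 2 then 1 else 0 := by
    split_ifs with h1 h2 h2
    · rw [he.coord_apply hk hkn (by omega) (by omega), if_pos h2.1]
    · rw [he.coord_apply hk hkn (by omega) (by omega), if_neg (by omega)]
    · omega
    · exact map_zero _
  rw [ht i j hi hin hj hjn, map_add, map_add, map_add, hij]
  simp only [apply_ite (he.coord k), map_smul, map_zero, hn, smul_eq_mul, mul_ite, mul_one,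
    mul_zero, ← ite_and, and_assoc]

theorem coord_one_mul (hn : 5 < n) (u v : A) : he.coord 1 (u * v) = 0 := by
  refine he.ext_bilin (f := (LinearMap.mul ℂ A).compr₂ (he.coord 1)) (g := 0) ?_ u v
  intro i j hi hin hj hjn
  simp only [LinearMap.compr₂_apply, LinearMap.mul_apply',
    he.coord_mul_basis ht le_rfl (show 1 ≤ n by omega) hi hin hj hjn, LinearMap.zero_apply]
  simp [show ¬(i + j = 1) by omega, show 1 ≠ n by omega]

theorem coord_pred_mul (hn : 5 < n) (u v : A) : he.coord (n - 1) (u * v) = 0 := by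
  refine he.ext_bilin (f := (LinearMap.mul ℂ A).compr₂ (he.coord (n - 1))) (g := 0) ?_ u v
  intro i j hi hin hj hjn
  simp only [LinearMap.compr₂_apply, LinearMap.mul_apply',
    he.coord_mul_basis ht (show 1 ≤ n - 1 by omega) (show n - 1 ≤ n by omega) hi hin hj hjn,
    LinearMap.zero_apply]
  simp [show ¬(n - 1 ≤ n - 2) by omega, show n - 1 ≠ n by omega]

theorem coord_two_mul (hn : 5 < n) (u v : A) :
    he.coord 2 (u * v) = he.coord 1 u * he.coord 1 v := by
  refine he.ext_bilin (f := (LinearMap.mul ℂ A).compr₂ (he.coord 2))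
    (g := (LinearMap.mul ℂ ℂ).compl₁₂ (he.coord 1) (he.coord 1)) ?_ u v
  intro i j hi hin hj hjn
  simp only [LinearMap.compr₂_apply, LinearMap.compl₁₂_apply, LinearMap.mul_apply',
    he.coord_mul_basis ht (show 1 ≤ 2 by omega) (show 2 ≤ n by omega) hi hin hj hjn,
    he.coord_apply le_rfl (show 1 ≤ n by omega) hi hin,
    he.coord_apply le_rfl (show 1 ≤ n by omega) hj hjn]
  simp only [show 2 ≠ n by omega, show 2 ≤ n - 2 by omega, and_false, if_false, add_zero, and_true]
  split_ifs <;> first | omega | simp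

theorem coord_three_mul (hn : 5 < n) (u v : A) :
    he.coord 3 (u * v) = he.coord 1 u * he.coord 2 v + he.coord 2 u * he.coord 1 v := by
  refine he.ext_bilin (f := (LinearMap.mul ℂ A).compr₂ (he.coord 3))
    (g := (LinearMap.mul ℂ ℂ).compl₁₂ (he.coord 1) (he.coord 2) +
      (LinearMap.mul ℂ ℂ).compl₁₂ (he.coord 2) (he.coord 1)) ?_ u v
  intro i j hi hin hj hjn
  simp only [LinearMap.compr₂_apply, LinearMap.compl₁₂_apply, LinearMap.mul_apply',
    LinearMap.add_apply,
    he.coord_mul_basis ht (show 1 ≤ 3 by omega) (show 3 ≤ n by omega) hi hin hj hjn,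
    he.coord_apply le_rfl (show 1 ≤ n by omega) hi hin,
    he.coord_apply le_rfl (show 1 ≤ n by omega) hj hjn,
    he.coord_apply one_le_two (show 2 ≤ n by omega) hi hin,
    he.coord_apply one_le_two (show 2 ≤ n by omega) hj hjn]
  simp only [show 3 ≠ n by omega, show 3 ≤ n - 2 by omega, and_false, if_false, add_zero, and_true]
  split_ifs <;> first | omega | simp

theorem coord_last_mul (hn : 5 < n) (u v : A) :
    he.coord n (u * v) = (quasiCoeff t).1 * (he.coord (n - 1) u * he.coord 1 v) +
      (quasiCoeff t).2.1 * (he.coord 1 u * he.coord (n - 1) v) +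
      (quasiCoeff t).2.2 * (he.coord (n - 1) u * he.coord (n - 1) v) := by
  refine he.ext_bilin (f := (LinearMap.mul ℂ A).compr₂ (he.coord n))
    (g := (quasiCoeff t).1 • (LinearMap.mul ℂ ℂ).compl₁₂ (he.coord (n - 1)) (he.coord 1) +
      (quasiCoeff t).2.1 • (LinearMap.mul ℂ ℂ).compl₁₂ (he.coord 1) (he.coord (n - 1)) +
      (quasiCoeff t).2.2 • (LinearMap.mul ℂ ℂ).compl₁₂ (he.coord (n - 1)) (he.coord (n - 1)))
    ?_ u v
  intro i j hi hin hj hjn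
  simp only [LinearMap.compr₂_apply, LinearMap.compl₁₂_apply, LinearMap.mul_apply',
    LinearMap.add_apply, LinearMap.smul_apply, smul_eq_mul,
    he.coord_mul_basis ht (show 1 ≤ n by omega) le_rfl hi hin hj hjn,
    he.coord_apply le_rfl (show 1 ≤ n by omega) hi hin,
    he.coord_apply le_rfl (show 1 ≤ n by omega) hj hjn,
    he.coord_apply (show 1 ≤ n - 1 by omega) (show n - 1 ≤ n by omega) hi hin,
    he.coord_apply (show 1 ≤ n - 1 by omega) (show n - 1 ≤ n by omega) hj hjn]
  simp only [show ¬(n ≤ n - 2) by omega, and_false, if_false, and_true, ← ite_and, mul_ite, mul_one,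
    mul_zero, zero_add]
  simp only [and_comm]

theorem mul_pred_one (hn : 5 < n) : e (n - 1) * e 1 = (quasiCoeff t).1 • e n := by
  rw [ht (n - 1) 1 (by omega) (by omega) le_rfl (by omega)]
  simp [show ¬(n - 1 + 1 ≤ n - 2) by omega, show 1 ≠ n - 1 by omega]

theorem mul_one_pred (hn : 5 < n) : e 1 * e (n - 1) = (quasiCoeff t).2.1 • e n := by
  rw [ht 1 (n - 1) le_rfl (by omega) (by omega) (by omega)]
  simp [show ¬(1 + (n - 1) ≤ n - 2) by omega, show 1 ≠ n - 1 by omega]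

theorem mul_pred_pred (hn : 5 < n) : e (n - 1) * e (n - 1) = (quasiCoeff t).2.2 • e n := by
  rw [ht (n - 1) (n - 1) (by omega) (by omega) (by omega) (by omega)]
  simp [show ¬(n - 1 + (n - 1) ≤ n - 2) by omega, show n - 1 ≠ 1 by omega]

/-- A functional vanishing on all products is determined by its values at `e 1` and
`e (n - 1)`. -/
theorem apply_eq_of_mul_eq_zero (hn : 5 < n) (f : A →ₗ[ℂ] ℂ) (hf : ∀ u v, f (u * v) = 0) (w : A) :
    f w = he.coord 1 w * f (e 1) + he.coord (n - 1) w * f (e (n - 1)) := by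
  refine he.induction (p := fun w => f w = he.coord 1 w * f (e 1) +
    he.coord (n - 1) w * f (e (n - 1))) (by simp) (fun u v hu hv => ?_) (fun c u hu => ?_)
    (fun i hi hin => ?_) w
  · rw [map_add, hu, hv, map_add, map_add]; ring
  · rw [map_smul, hu, map_smul, map_smul]; simp only [smul_eq_mul]; ring
  · rw [he.coord_apply le_rfl (by omega) hi hin, he.coord_apply (by omega) (by omega) hi hin]
    by_cases h1 : i = 1
    · subst h1
      simp [show 1 ≠ n - 1 by omega]
    by_cases h2 : i = n - 1
    · subst h2
      simp [h1]
    rw [if_neg h1, if_neg h2, zero_mul, zero_mul, add_zero]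
    by_cases h3 : i = n
    · subst h3
      have key {u v : A} {d : ℂ} (hd : u * v = d • e i) (hd0 : d ≠ 0) : f (e i) = 0 := by
        have := hf u v
        rw [hd, map_smul, smul_eq_mul] at this
        exact (mul_eq_zero.1 this).resolve_left hd0
      rcases t with t | α
      · fin_cases t
        · exact key (mul_pred_one ht hn) (by simp [quasiCoeff])
        · exact key (mul_one_pred ht hn) (by simp [quasiCoeff])
        · exact key (mul_one_pred ht hn) (by simp [quasiCoeff])
      · exact key (mul_one_pred ht hn) (by simp [quasiCoeff])
    · have : e i = e 1 * e (i - 1) := by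
        rw [ht 1 (i - 1) le_rfl (by omega) (by omega) (by omega)]
        simp [show 1 + (i - 1) = i by omega, show 2 ≤ i by omega, show i ≤ n - 2 by omega,
          show 1 ≠ n - 1 by omega, show i - 1 ≠ n - 1 by omega]
      rw [this, hf]

end IsBasisFam

end

theorem eq_of_quasiCoeff_proportional {t t' : Fin 3 ⊕ ℂ} {l p q r : ℂ} (hp : p ≠ 0) (hr : r ≠ 0)
    (h1 : (quasiCoeff t).1 * l = r * ((quasiCoeff t').1 * p + (quasiCoeff t').2.2 * q))
    (h2 : (quasiCoeff t).2.1 * l = r * ((quasiCoeff t').2.1 * p + (quasiCoeff t').2.2 * q))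
    (h3 : (quasiCoeff t).2.2 * l = r ^ 2 * (quasiCoeff t').2.2) : t = t' := by
  rcases t with t | α <;> rcases t' with t' | β
  · fin_cases t <;> fin_cases t' <;> simp [quasiCoeff] at h1 h2 h3 ⊢ <;> grind
  · fin_cases t <;> simp [quasiCoeff] at h1 h2 h3 <;> grind
  · fin_cases t' <;> simp [quasiCoeff] at h1 h2 h3 <;> grind
  · simp [quasiCoeff] at h1 h2 h3 ⊢
    grind

/-- Isomorphic algebras with quasi-filiform tables have the same table. -/
theorem quasiFiliformTable_unique {n : ℕ} (hn : 5 < n) {t t' : Fin 3 ⊕ ℂ}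
    {B : Type*} [NonUnitalRing B] [Module ℂ B] [SMulCommClass ℂ B B] [IsScalarTower ℂ B B]
    {C : Type*} [NonUnitalRing C] [Module ℂ C] [SMulCommClass ℂ C C] [IsScalarTower ℂ C C]
    {eB : ℕ → B} {eC : ℕ → C} (hB : IsBasisFam B n eB) (tB : QuasiFiliformTable B n t eB)
    (hC : IsBasisFam C n eC) (tC : QuasiFiliformTable C n t' eC) (φ : B ≃ₗ[ℂ] C)
    (hφ : ∀ x y : B, φ (x * y) = φ x * φ y) : t = t' := by
  have hcube : eB (n - 1) * eB (n - 1) * eB (n - 1) = 0 := by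
    rw [IsBasisFam.mul_pred_pred tB hn, smul_mul_assoc,
      tB n (n - 1) (by omega) le_rfl (by omega) (by omega)]
    simp [show ¬(n + (n - 1) ≤ n - 2) by omega, show n ≠ n - 1 by omega, show n ≠ 1 by omega]
  have hX : hC.coord 1 (φ (eB (n - 1))) = 0 := by
    have := congrArg (fun w => hC.coord 3 (φ w)) hcube
    simp only [hφ, hC.coord_three_mul tC hn, hC.coord_two_mul tC hn, hC.coord_one_mul tC hn,
      map_zero, zero_mul, zero_add] at this
    simpa using this
  have e1 := hB.apply_eq_of_mul_eq_zero tB hn (hC.coord 1 ∘ₗ φ.toLinearMap)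
    (fun u v => by simp [hφ, hC.coord_one_mul tC hn])
  have e2 := hB.apply_eq_of_mul_eq_zero tB hn (hC.coord (n - 1) ∘ₗ φ.toLinearMap)
    (fun u v => by simp [hφ, hC.coord_pred_mul tC hn])
  simp only [LinearMap.comp_apply, LinearEquiv.coe_coe, hX, mul_zero, add_zero] at e1 e2
  have hp : hC.coord 1 (φ (eB 1)) ≠ 0 := by
    intro h0
    have := e1 (φ.symm (eC 1))
    rw [LinearEquiv.apply_symm_apply, hC.coord_apply le_rfl (by omega) le_rfl (by omega), h0] at this
    simp at this
  have hr : hC.coord (n - 1) (φ (eB (n - 1))) ≠ 0 := by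
    intro h0
    have h1 := e1 (φ.symm (eC (n - 1)))
    have h2 := e2 (φ.symm (eC (n - 1)))
    rw [LinearEquiv.apply_symm_apply, hC.coord_apply le_rfl (by omega) (by omega) (by omega),
      if_neg (by omega)] at h1
    rw [LinearEquiv.apply_symm_apply, hC.coord_apply (by omega) (by omega) (by omega) (by omega),
      (mul_eq_zero.1 h1.symm).resolve_right hp, h0] at h2
    simp at h2
  have f1 := congrArg (fun w => hC.coord n (φ w)) (IsBasisFam.mul_pred_one tB hn)
  have f2 := congrArg (fun w => hC.coord n (φ w)) (IsBasisFam.mul_one_pred tB hn)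
  have f3 := congrArg (fun w => hC.coord n (φ w)) (IsBasisFam.mul_pred_pred tB hn)
  simp only [hφ, map_smul, smul_eq_mul, hC.coord_last_mul tC hn, hX] at f1 f2 f3
  exact eq_of_quasiCoeff_proportional (l := hC.coord n (φ (eB n)))
    (q := hC.coord (n - 1) (φ (eB 1))) hp hr (by rw [← f1]; ring) (by rw [← f2]; ring)
    (by rw [← f3]; ring)

/-- every `n`-dimensional (`n > 5`) naturally graded non-split nilpotent
complex associative algebra of nilindex `n-2` has a basis realizing exactly one of the
tables `μ_{2,1}`, `μ_{2,2}(α)` (`α ∈ ℂ`), `μ_{2,3}`, `μ_{2,4}`, and these tables define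
pairwise non-isomorphic algebras. -/
theorem quasi_filiform_classification (n : ℕ) (hn : 5 < n) [FiniteDimensional ℂ A]
    (hdim : Module.finrank ℂ A = n) (hnil : IsNilpotentAlg A)
    (hgraded : ∃ 𝒜 : ℕ → Submodule ℂ A, IsNaturalGrading A 𝒜)
    (hnonsplit : NonSplit A)
    (hqf₁ : algPow A (n - 2) ≠ ⊥) (hqf₂ : algPow A (n - 1) = ⊥) :
    (∃! t : Fin 3 ⊕ ℂ, ∃ e : ℕ → A, IsBasisFam A n e ∧ QuasiFiliformTable A n t e) ∧
    (∀ t t' : Fin 3 ⊕ ℂ, t ≠ t' →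
      ∀ (B : Type*) [NonUnitalRing B] [Module ℂ B] [SMulCommClass ℂ B B] [IsScalarTower ℂ B B]
        (C : Type*) [NonUnitalRing C] [Module ℂ C] [SMulCommClass ℂ C C] [IsScalarTower ℂ C C]
        (eB : ℕ → B) (eC : ℕ → C),
        IsBasisFam B n eB → QuasiFiliformTable B n t eB →
        IsBasisFam C n eC → QuasiFiliformTable C n t' eC →
        ¬ ∃ φ : B ≃ₗ[ℂ] C, ∀ x y : B, φ (x * y) = φ x * φ y) := by
  refine ⟨?_, fun t t' hne B _ _ _ _ C _ _ _ _ eB eC hB tB hC tC ⟨φ, hφ⟩ =>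
    hne (quasiFiliformTable_unique hn hB tB hC tC φ hφ)⟩
  obtain ⟨𝒜, h⟩ := hgraded
  obtain ⟨x, y, z, a, b, c, hf⟩ :=
    h.exists_isQuasiFrame_of_nonSplit hn hdim hnonsplit hqf₁ hqf₂
  obtain ⟨t, e, he, ht⟩ := hf.exists_normal_form hn hdim
  refine ⟨t, ⟨e, he, ht⟩, ?_⟩
  rintro t' ⟨e', he', ht'⟩
  exact quasiFiliformTable_unique hn he' ht' he ht (LinearEquiv.refl ℂ A) fun _ _ => rfl
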